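/- arXiv:1508.03187 — 3 statements merged into one kernel-verified Lean document; each statement's English description precedes it below -/
import Mathlib

section
/- If E is a C*-embedded subspace of the Sorgenfrey plane 𝕊² that is discrete in the subspace topology inherited from 𝕊², then E is countable and E is a Gδ-set in the Euclidean topology of ℝ². -/
open Topology Set

/-- The Sorgenfrey topology on ℝ, generated by half-open intervals `[a, b)`. -/
def sorgTop : TopologicalSpace ℝ :=
  TopologicalSpace.generateFrom {s : Set ℝ | ∃ a b : ℝ, s = Set.Ico a b}

/-- The Sorgenfrey plane topology on ℝ × ℝ: the product of two Sorgenfrey topologies. -/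
def sorgPlane : TopologicalSpace (ℝ × ℝ) := @instTopologicalSpaceProd ℝ ℝ sorgTop sorgTop

/-- `A` and `B` are completely separated in `(X, t)`. -/
def CompletelySeparatedIn {X : Type*} (t : TopologicalSpace X) (A B : Set X) : Prop :=
  ∃ f : X → ℝ, Continuous[t, inferInstance] f ∧ (∀ x, f x ∈ Set.Icc (0:ℝ) 1) ∧
    (∀ x ∈ A, f x = 0) ∧ (∀ x ∈ B, f x = 1)

/-- `A` is functionally closed (a zero-set) in `(X, t)`. -/
def FunctionallyClosedIn {X : Type*} (t : TopologicalSpace X) (A : Set X) : Prop :=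
  ∃ f : X → ℝ, Continuous[t, inferInstance] f ∧ (∀ x, f x ∈ Set.Icc (0:ℝ) 1) ∧
    A = f ⁻¹' {0}

/-- `E` is C*-embedded in `(X, t)`: every bounded continuous real function on `E`
(with the subspace topology) extends continuously to `X`. -/
def CStarEmbedded {X : Type*} (t : TopologicalSpace X) (E : Set X) : Prop :=
  ∀ f : E → ℝ, Continuous[t.induced ((↑) : E → X), inferInstance] f →
    (∃ M : ℝ, ∀ x, |f x| ≤ M) →
    ∃ g : X → ℝ, Continuous[t, inferInstance] g ∧ ∀ x : E, g x = f x

/-- `E` is C-embedded in `(X, t)`: every continuous real function on `E`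
(with the subspace topology) extends continuously to `X`. -/
def CEmbedded {X : Type*} (t : TopologicalSpace X) (E : Set X) : Prop :=
  ∀ f : E → ℝ, Continuous[t.induced ((↑) : E → X), inferInstance] f →
    ∃ g : X → ℝ, Continuous[t, inferInstance] g ∧ ∀ x : E, g x = f x

/-- `E` is z-embedded in `(X, t)`: every functionally closed subset of `E` is the trace
on `E` of a functionally closed subset of `X`. -/
def ZEmbedded {X : Type*} (t : TopologicalSpace X) (E : Set X) : Prop :=
  ∀ Z : Set E, FunctionallyClosedIn (t.induced ((↑) : E → X)) Z →
    ∃ W : Set X, FunctionallyClosedIn t W ∧ ((↑) : E → X) ⁻¹' W = Z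

/-- Infinitely many infinite sets admit an injective choice of representatives. -/
theorem exists_injective_forall_mem_of_infinite {α : Type*} {C : ℕ → Set α}
    (hC : ∀ n, (C n).Infinite) : ∃ x : ℕ → α, Function.Injective x ∧ ∀ n, x n ∈ C n := by
  classical
  choose y hyC hy using fun n (s : Finset α) => (hC n).exists_notMem_finset s
  let S : ℕ → Finset α := fun n => Nat.rec ∅ (fun n s => insert (y n s) s) n
  have hS : ∀ n, S (n + 1) = insert (y n (S n)) (S n) := fun _ => rfl
  have hmono : Monotone S := monotone_nat_of_le_succ fun n => by
    rw [hS]; exact Finset.subset_insert _ _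
  have hlt : ∀ m n, m < n → y m (S m) ≠ y n (S n) := fun m n hmn h => by
    refine hy n (S n) (hmono (Nat.succ_le_of_lt hmn) ?_)
    rw [← h, Nat.succ_eq_add_one, hS]
    exact Finset.mem_insert_self _ _
  refine ⟨fun n => y n (S n), fun m n h => ?_, fun n => hyC _ _⟩
  by_contra hmn
  rcases Nat.lt_or_gt_of_ne hmn with hmn | hmn
  exacts [hlt _ _ hmn h, hlt _ _ hmn h.symm]

/-- A crowded subset of a second countable T₁ space is resolvable. -/
theorem Preperfect.exists_subset_closure_diff {X : Type*} [TopologicalSpace X] [T1Space X]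
    [SecondCountableTopology X] {K : Set X} (hK : Preperfect K) :
    ∃ D ⊆ K, K ⊆ closure D ∧ K ⊆ closure (K \ D) := by
  rcases K.eq_empty_or_nonempty with rfl | ⟨x₀, hx₀⟩
  · exact ⟨∅, by simp⟩
  open TopologicalSpace in
  let B : Set (Set X) := {U ∈ countableBasis X | (U ∩ K).Nonempty}
  have hmem : ∀ x ∈ K, ∀ V, IsOpen V → x ∈ V → ∃ U ∈ B, U ⊆ V := fun x hx V hV hxV => by
    obtain ⟨U, hU, hxU, hUV⟩ :=
      (TopologicalSpace.isBasis_countableBasis X).exists_subset_of_mem_open hxV hV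
    exact ⟨U, ⟨hU, x, hxU, hx⟩, hUV⟩
  have hBc : B.Countable := (TopologicalSpace.countable_countableBasis X).mono fun _ h => h.1
  have hBn : B.Nonempty := by
    obtain ⟨U, hU, -⟩ := hmem x₀ hx₀ univ isOpen_univ trivial
    exact ⟨U, hU⟩
  obtain ⟨b, hb⟩ := hBc.exists_eq_range hBn
  have hbB : ∀ n, b n ∈ B := fun n => hb ▸ mem_range_self n
  have hinf : ∀ n, (b n ∩ K).Infinite := fun n => by
    obtain ⟨hU, x, hx⟩ := hbB n
    exact .of_accPt (hK.open_inter (TopologicalSpace.isOpen_of_mem_countableBasis hU) x hx)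
  obtain ⟨x, hxi, hx⟩ := exists_injective_forall_mem_of_infinite fun n => hinf (n / 2)
  refine ⟨range fun n => x (2 * n), ?_, fun p hp => ?_, fun p hp => ?_⟩
  · rintro _ ⟨n, rfl⟩
    exact (hx _).2
  all_goals
    refine mem_closure_iff.2 fun V hV hpV => ?_
    obtain ⟨U, hU, hUV⟩ := hmem p hp V hV hpV
    rw [hb] at hU
    obtain ⟨n, rfl⟩ := hU
  · refine ⟨x (2 * n), hUV ?_, mem_range_self n⟩
    simpa using (hx (2 * n)).1
  · have h := hx (2 * n + 1)
    rw [show (2 * n + 1) / 2 = n by lia] at h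
    refine ⟨x (2 * n + 1), hUV h.1, h.2, ?_⟩
    rintro ⟨m, hm⟩
    have := hxi hm
    lia

/-- A scattered subset of a second countable metrizable space is a countable Gδ set. -/
theorem countable_and_isGδ_of_scattered {X : Type*} [TopologicalSpace X]
    [TopologicalSpace.MetrizableSpace X] [SecondCountableTopology X] {E : Set X}
    (hE : ∀ K ⊆ E, Preperfect K → K = ∅) : E.Countable ∧ IsGδ E := by
  let G : Set (Set X) := {U | IsOpen U ∧ (U ∩ E).Countable ∧ IsGδ (U ∩ E)}
  obtain ⟨T, hTc, hTG, hT⟩ := TopologicalSpace.isOpen_sUnion_countable G fun _ h => h.1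
  set V := ⋃₀ G
  have hVo : IsOpen V := isOpen_sUnion fun _ h => h.1
  have hcount : (V ∩ E).Countable := by
    refine (hTc.biUnion fun U hU => (hTG hU).2.1).mono ?_
    rw [← hT]
    rintro x ⟨⟨U, hU, hxU⟩, hxE⟩
    exact mem_biUnion hU ⟨hxU, hxE⟩
  have hGδ : IsGδ (V ∩ E) := by
    have : V ∩ E = V ∩ ⋂₀ ((fun U => Uᶜ ∪ (U ∩ E)) '' T) := by
      rw [← hT]
      ext x
      simp only [mem_inter_iff, mem_sUnion, sInter_image, mem_iInter, mem_union, mem_compl_iff]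
      grind
    rw [this]
    refine hVo.isGδ.inter (.sInter ?_ (hTc.image _))
    rintro _ ⟨U, hU, rfl⟩
    exact (hTG hU).1.isClosed_compl.isGδ.union (hTG hU).2.2
  suffices h : E ⊆ V by
    rw [inter_eq_right.2 h] at hcount hGδ
    exact ⟨hcount, hGδ⟩
  rw [← sdiff_eq_empty]
  refine hE _ sdiff_subset fun p hp => ?_
  by_contra hacc
  rw [accPt_iff_nhds] at hacc
  push Not at hacc
  obtain ⟨U, hU, hUp⟩ := hacc
  obtain ⟨W, hWU, hWo, hpW⟩ := mem_nhds_iff.1 hU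
  have hWE : W ∩ E = W ∩ (V ∩ E) ∪ {p} := by
    ext x
    have := hUp x
    have := @hWU x
    simp only [mem_inter_iff, mem_union, mem_singleton_iff, mem_sdiff] at *
    grind
  refine hp.2 (mem_sUnion.2 ⟨W, ⟨hWo, ?_, ?_⟩, hpW⟩) <;> rw [hWE]
  · exact (hcount.mono inter_subset_right).union (countable_singleton p)
  · exact (hWo.isGδ.inter hGδ).union (.singleton p)

theorem exists_Ico_subset_of_isOpen_sorgTop {U : Set ℝ} (hU : IsOpen[sorgTop] U) {x : ℝ}
    (hx : x ∈ U) : ∃ ε > 0, Ico x (x + ε) ⊆ U := by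
  induction hU generalizing x with
  | basic s hs =>
    obtain ⟨a, b, rfl⟩ := hs
    exact ⟨b - x, sub_pos.2 hx.2, fun y hy => ⟨hx.1.trans hy.1, by linarith [hy.2]⟩⟩
  | univ => exact ⟨1, one_pos, subset_univ _⟩
  | inter s t _ _ hs ht =>
    obtain ⟨ε, hε, h⟩ := hs hx.1
    obtain ⟨δ, hδ, h'⟩ := ht hx.2
    refine ⟨min ε δ, lt_min hε hδ, fun y hy => ⟨h ⟨hy.1, ?_⟩, h' ⟨hy.1, ?_⟩⟩⟩
    · linarith [hy.2, min_le_left ε δ]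
    · linarith [hy.2, min_le_right ε δ]
  | sUnion S _ ih =>
    obtain ⟨s, hs, hxs⟩ := hx
    obtain ⟨ε, hε, h⟩ := ih s hs hxs
    exact ⟨ε, hε, h.trans (subset_sUnion_of_mem hs)⟩

theorem exists_Ico_prod_subset_of_isOpen_sorgPlane {U : Set (ℝ × ℝ)} (hU : IsOpen[sorgPlane] U)
    {p : ℝ × ℝ} (hp : p ∈ U) :
    ∃ ε > 0, Ico p.1 (p.1 + ε) ×ˢ Ico p.2 (p.2 + ε) ⊆ U := by
  obtain ⟨u, v, hu, hv, hpu, hpv, huv⟩ := (@isOpen_prod_iff ℝ ℝ sorgTop sorgTop U).1 hU p.1 p.2 hp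
  obtain ⟨ε, hε, h⟩ := exists_Ico_subset_of_isOpen_sorgTop hu hpu
  obtain ⟨δ, hδ, h'⟩ := exists_Ico_subset_of_isOpen_sorgTop hv hpv
  refine ⟨min ε δ, lt_min hε hδ, fun y hy => huv ⟨h ⟨hy.1.1, ?_⟩, h' ⟨hy.2.1, ?_⟩⟩⟩
  · linarith [hy.1.2, min_le_left ε δ]
  · linarith [hy.2.2, min_le_right ε δ]

/-- Sublevel sets of continuous functions on the Sorgenfrey plane are Gδ in the Euclidean plane. -/
theorem isGδ_setOf_le_of_continuous_sorgPlane {f : ℝ × ℝ → ℝ}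
    (hf : Continuous[sorgPlane, inferInstance] f) (a : ℝ) : IsGδ {p | f p ≤ a} := by
  let W : ℝ → Set (ℝ × ℝ) := fun r => {p | ∃ q : ℝ × ℝ, f q < a + r ∧
    (p.1 < q.1 ∧ q.1 < p.1 + r) ∧ p.2 < q.2 ∧ q.2 < p.2 + r}
  have hWo : ∀ r, IsOpen (W r) := fun r => by
    simp only [W, ofPred_exists]
    refine isOpen_iUnion fun q => ?_
    refine isOpen_const.and (.and (.and ?_ ?_) (.and ?_ ?_)) <;>
      exact isOpen_lt (by fun_prop) (by fun_prop)
  have hnear : ∀ p b, f p < b → ∃ ε > 0, ∀ q ∈ Ico p.1 (p.1 + ε) ×ˢ Ico p.2 (p.2 + ε), f q < b :=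
    fun p b hb => exists_Ico_prod_subset_of_isOpen_sorgPlane
      ((continuous_def.1 hf) (Iio b) isOpen_Iio) hb
  have hnear' : ∀ p b, b < f p → ∃ ε > 0, ∀ q ∈ Ico p.1 (p.1 + ε) ×ˢ Ico p.2 (p.2 + ε), b < f q :=
    fun p b hb => exists_Ico_prod_subset_of_isOpen_sorgPlane
      ((continuous_def.1 hf) (Ioi b) isOpen_Ioi) hb
  have : {p | f p ≤ a} = ⋂ n : ℕ, W (1 / (n + 1)) := by
    ext p
    simp only [mem_ofPred_eq, mem_iInter]
    refine ⟨fun hp n => ?_, fun hp => ?_⟩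
    · have hr : (0 : ℝ) < 1 / (n + 1) := by positivity
      obtain ⟨ε, hε, h⟩ := hnear p (a + 1 / (n + 1)) (by linarith)
      obtain ⟨δ, hδ, hδ'⟩ := exists_between (lt_min hε hr)
      obtain ⟨h₁, h₂⟩ := lt_min_iff.1 hδ'
      refine ⟨(p.1 + δ, p.2 + δ), h _ ⟨⟨?_, ?_⟩, ?_, ?_⟩, ⟨?_, ?_⟩, ?_, ?_⟩ <;>
        dsimp only <;> linarith
    · by_contra! hlt
      obtain ⟨b, hab, hb⟩ := exists_between hlt
      obtain ⟨ε, hε, h⟩ := hnear' p b hb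
      obtain ⟨n, hn⟩ := exists_nat_one_div_lt (lt_min hε (sub_pos.2 hab))
      obtain ⟨h₁, h₂⟩ := lt_min_iff.1 hn
      obtain ⟨q, hq, ⟨hq₁, hq₂⟩, hq₃, hq₄⟩ := hp n
      have := h q ⟨⟨hq₁.le, by linarith⟩, hq₃.le, by linarith⟩
      linarith
  rw [this]
  exact .iInter_of_isOpen fun n => hWo _

theorem nonempty_inter_of_isGδ_of_subset_closure {X : Type*} [TopologicalSpace X]
    [TopologicalSpace.IsCompletelyMetrizableSpace X] {A B K S T : Set X} (hK : K.Nonempty)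
    (hS : IsGδ S) (hT : IsGδ T) (hAK : A ⊆ K) (hBK : B ⊆ K) (hA : K ⊆ closure A)
    (hB : K ⊆ closure B) (hAS : A ⊆ S) (hBT : B ⊆ T) : (S ∩ T).Nonempty := by
  have : TopologicalSpace.IsCompletelyMetrizableSpace (closure K) :=
    isClosed_closure.isCompletelyMetrizableSpace
  have : Nonempty (closure K) := hK.closure.to_subtype
  have hdense : ∀ {C R : Set X}, C ⊆ K → K ⊆ closure C → C ⊆ R →
      Dense ((↑) ⁻¹' R : Set (closure K)) := fun {C R} hCK hKC hCR => by
    rw [Subtype.dense_iff]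
    refine (closure_minimal hKC isClosed_closure).trans (closure_mono fun x hx => ?_)
    exact ⟨⟨x, subset_closure (hCK hx)⟩, hCR hx, rfl⟩
  obtain ⟨x, hx⟩ := (Dense.inter_of_Gδ (hS.preimage continuous_subtype_val)
    (hT.preimage continuous_subtype_val) (hdense hAK hA hAS) (hdense hBK hB hBT)).nonempty
  exact ⟨x, hx⟩

theorem CStarEmbedded.preperfect_eq_empty {E : Set (ℝ × ℝ)} (hE : CStarEmbedded sorgPlane E)
    (hdisc : ∀ p ∈ E, ∃ U : Set (ℝ × ℝ), IsOpen[sorgPlane] U ∧ U ∩ E = {p})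
    {K : Set (ℝ × ℝ)} (hKE : K ⊆ E) (hK : Preperfect K) : K = ∅ := by
  classical
  by_contra hne
  obtain ⟨D, hDK, hD, hD'⟩ := hK.exists_subset_closure_diff
  have hdiscrete : sorgPlane.induced ((↑) : E → ℝ × ℝ) = ⊥ := by
    refine eq_bot_of_singletons_open fun p => ?_
    obtain ⟨U, hU, hUE⟩ := hdisc p p.2
    refine ⟨U, hU, ?_⟩
    ext q
    have := Set.ext_iff.1 hUE q
    simpa [Subtype.ext_iff] using this
  obtain ⟨g, hg, hgE⟩ := hE (fun p => if (p : ℝ × ℝ) ∈ D then 0 else 1)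
    (by rw [hdiscrete]; exact continuous_bot) ⟨1, fun p => by split_ifs <;> simp⟩
  have hg' : Continuous[sorgPlane, inferInstance] (fun p => -g p) :=
    @Continuous.comp _ _ _ sorgPlane _ _ _ _ continuous_neg hg
  obtain ⟨p, hp, hp'⟩ := nonempty_inter_of_isGδ_of_subset_closure
    (nonempty_iff_ne_empty.2 hne)
    (isGδ_setOf_le_of_continuous_sorgPlane hg 0) (isGδ_setOf_le_of_continuous_sorgPlane hg' (-1))
    hDK sdiff_subset hD hD'
    (fun p hp => by simpa [hp] using (hgE ⟨p, hKE (hDK hp)⟩).le)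
    (fun p hp => by simpa [hp.2] using (hgE ⟨p, hKE hp.1⟩).ge)
  simp only [mem_ofPred_eq] at hp hp'
  linarith

/-- Every discrete C*-embedded subspace of the Sorgenfrey plane is a countable
Gδ-subspace of the Euclidean plane. -/
theorem discrete_cstarEmbedded_countable_Gdelta (E : Set (ℝ × ℝ))
    (hE : CStarEmbedded sorgPlane E)
    (hdisc : ∀ p ∈ E, ∃ U : Set (ℝ × ℝ), IsOpen[sorgPlane] U ∧ U ∩ E = {p}) :
    E.Countable ∧ IsGδ E :=
  countable_and_isGδ_of_scattered fun _ hKE hK => hE.preperfect_eq_empty hdisc hKE hK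
end

section
/- Let 𝔻 = {(x, −x) : x ∈ ℝ} be the anti-diagonal of the Sorgenfrey plane 𝕊². If E ⊆ 𝔻 is countable and functionally closed in 𝕊², then E is C-embedded in 𝕊²: every continuous function f : E → ℝ extends to a continuous function on all of 𝕊². -/
open Topology Set

/-- A continuous nonnegative function whose nonzero set is the union of a sequence of clopen
sets. -/
theorem exists_continuous_pos_iff_mem_iUnion_isClopen {X : Type*} [TopologicalSpace X]
    {U : ℕ → Set X} (hU : ∀ n, IsClopen (U n)) :
    ∃ h : X → ℝ, Continuous h ∧ (∀ x, 0 ≤ h x) ∧ ∀ x, 0 < h x ↔ ∃ n, x ∈ U n := by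
  have hnonneg : ∀ n x, 0 ≤ (U n).indicator (fun _ => ((1 : ℝ) / 2) ^ n) x := fun n x =>
    indicator_nonneg (fun _ _ => by positivity) x
  have hle : ∀ n x, (U n).indicator (fun _ => ((1 : ℝ) / 2) ^ n) x ≤ (1 / 2) ^ n := fun n x =>
    indicator_le_self' (fun _ _ => by positivity) x
  have hsum : ∀ x, Summable fun n => (U n).indicator (fun _ => ((1 : ℝ) / 2) ^ n) x := fun x =>
    Summable.of_nonneg_of_le (fun n => hnonneg n x) (fun n => hle n x) summable_geometric_two
  refine ⟨fun x => ∑' n, (U n).indicator (fun _ => ((1 : ℝ) / 2) ^ n) x, ?_,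
    fun x => tsum_nonneg fun n => hnonneg n x, fun x => ⟨fun hx => ?_, ?_⟩⟩
  · refine continuous_tsum (fun n => continuous_const.indicator fun x hx => ?_)
      summable_geometric_two fun n x => ?_
    · simp [(hU n).frontier_eq] at hx
    · rw [Real.norm_of_nonneg (hnonneg n x)]
      exact hle n x
  · by_contra! hn
    simp [hn] at hx
  · rintro ⟨n, hn⟩
    refine (hsum x).tsum_pos (fun n => hnonneg n x) n ?_
    simp [hn]

/-- Every real function on a countable zero-set whose points are separated from each other by
clopen neighbourhoods extends continuously to the whole space. -/
theorem exists_continuous_extension_of_countable_zeroSet {X : Type*} [TopologicalSpace X]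
    {E : Set X} (hc : E.Countable) {F : X → ℝ} (hF : Continuous F) (hF0 : ∀ x, 0 ≤ F x)
    (hEF : ∀ x, x ∈ E ↔ F x = 0)
    (hsep : ∀ x ∈ E, ∃ U, IsClopen U ∧ x ∈ U ∧ ∀ y ∈ E, y ∈ U → y = x) (f : E → ℝ) :
    ∃ g : X → ℝ, Continuous g ∧ ∀ x : E, g x = f x := by
  classical
  rcases E.eq_empty_or_nonempty with rfl | hne
  · exact ⟨fun _ => 0, continuous_const, fun x => x.2.elim⟩
  have : Nonempty E := hne.to_subtype
  have : Countable E := hc.to_subtype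
  obtain ⟨e, he⟩ := exists_surjective_nat E
  choose U hU hmem huniq using fun n => hsep (e n) (e n).2
  obtain ⟨h, hcont, hnonneg, hpos⟩ := exists_continuous_pos_iff_mem_iUnion_isClopen hU
  let g : X → ℝ := fun x => if hx : ∃ n, x ∈ U n then f (e (Nat.find hx)) else 0
  have hg : ∀ x, (∃ n, x ∈ U n) → ContinuousAt g x := by
    intro x hx
    have hnhds : ∀ᶠ y in 𝓝 x, y ∈ U (Nat.find hx) ∧ ∀ m ∈ Iio (Nat.find hx), y ∉ U m :=
      ((hU _).isOpen.eventually_mem (Nat.find_spec hx)).and <|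
        (Filter.eventually_all_finite (finite_Iio _)).2 fun m hm =>
          (hU m).compl.isOpen.eventually_mem (Nat.find_min hx hm)
    refine continuousAt_const.congr (f := fun _ => g x) ?_
    filter_upwards [hnhds] with y hy
    have hy' : ∃ n, y ∈ U n := ⟨_, hy.1⟩
    have : Nat.find hy' = Nat.find hx := (Nat.find_eq_iff hy').2 ⟨hy.1, hy.2⟩
    simp only [g, dif_pos hx, dif_pos hy', this]
  refine ⟨fun x => g x * max 0 (1 - F x / h x), continuous_iff_continuousAt.2 fun x => ?_, ?_⟩
  · by_cases hx : ∃ n, x ∈ U n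
    · have hx0 : h x ≠ 0 := ((hpos x).2 hx).ne'
      exact (hg x hx).mul (continuousAt_const.max
        (continuousAt_const.sub (hF.continuousAt.div hcont.continuousAt hx0)))
    · have hxE : x ∉ E := by
        intro hxE
        obtain ⟨n, hn⟩ := he ⟨x, hxE⟩
        exact hx ⟨n, by simpa [hn] using hmem n⟩
      have hFx : 0 < F x := (hF0 x).lt_of_ne' fun h0 => hxE ((hEF x).2 h0)
      have hhx : h x = 0 := le_antisymm (not_lt.1 fun h0 => hx ((hpos x).1 h0)) (hnonneg x)
      refine continuousAt_const.congr (f := fun _ => (0 : ℝ)) ?_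
      filter_upwards [hcont.continuousAt.eventually_lt hF.continuousAt (hhx ▸ hFx)] with y hy
      by_cases hyU : ∃ n, y ∈ U n
      · have : 1 < F y / h y := (one_lt_div ((hpos y).2 hyU)).2 hy
        rw [max_eq_left (by linarith), mul_zero]
      · simp [g, hyU]
  · intro x
    obtain ⟨n, rfl⟩ := he x
    have hx : ∃ k, (e n : X) ∈ U k := ⟨n, hmem n⟩
    have : e n = e (Nat.find hx) := Subtype.ext (huniq _ _ (e n).2 (Nat.find_spec hx))
    simp [g, dif_pos hx, ← this, (hEF _).1 (e n).2]

theorem isClopen_Ico_sorgTop (a b : ℝ) : @IsClopen ℝ sorgTop (Ico a b) := by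
  let := sorgTop
  have hopen : ∀ c d : ℝ, IsOpen (Ico c d) := fun c d =>
    TopologicalSpace.isOpen_generateFrom_of_mem ⟨c, d, rfl⟩
  refine ⟨⟨isOpen_iff_forall_mem_open.2 fun x hx => ?_⟩, hopen a b⟩
  by_cases hxa : x < a
  · exact ⟨Ico x a, fun y hy hy' => hy.2.not_ge hy'.1, hopen _ _, left_mem_Ico.2 hxa⟩
  · have hbx : b ≤ x := not_lt.1 fun hxb => hx ⟨not_lt.1 hxa, hxb⟩
    exact ⟨Ico x (x + 1), fun y hy hy' => (hbx.trans hy.1).not_gt hy'.2, hopen _ _,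
      left_mem_Ico.2 (lt_add_one x)⟩

/-- A countable functionally closed subset of the anti-diagonal is C-embedded
in the Sorgenfrey plane. -/
theorem antidiagonal_countable_functionallyClosed_cEmbedded (E : Set (ℝ × ℝ))
    (hE : E ⊆ {p : ℝ × ℝ | p.2 = -p.1})
    (hc : E.Countable) (hF : FunctionallyClosedIn sorgPlane E) :
    CEmbedded sorgPlane E := by
  obtain ⟨F, hFc, hF01, hEF⟩ := hF
  intro f _
  refine @exists_continuous_extension_of_countable_zeroSet _ sorgPlane E hc F hFc
    (fun x => (hF01 x).1) (fun x => by simp [hEF]) (fun x hx => ?_) f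
  refine ⟨Ico x.1 (x.1 + 1) ×ˢ Ico x.2 (x.2 + 1), ?_, by simp, fun y hy hyU => ?_⟩
  · exact @IsClopen.prod _ _ sorgTop sorgTop _ _ (isClopen_Ico_sorgTop _ _)
      (isClopen_Ico_sorgTop _ _)
  · have hx' : x.2 = -x.1 := hE hx
    have hy' : y.2 = -y.1 := hE hy
    have h₁ : x.1 ≤ y.1 := hyU.1.1
    have h₂ : x.2 ≤ y.2 := hyU.2.1
    exact Prod.ext (by linarith) (by linarith)
end

section
/- The Sorgenfrey plane 𝕊² is not δ-normally separated. Concretely, the sets E = {(x, −x) : x ∈ ℚ} and F = {(x, −x) : x ∈ ℝ \ ℚ} satisfy: E is closed in 𝕊², F is functionally closed in 𝕊², E and F are disjoint, but E and F are not completely separated in 𝕊² (there is no continuous function f : 𝕊² → [0,1] with E ⊆ f⁻¹(0) and F ⊆ f⁻¹(1)). -/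
open Topology Set

theorem isOpen_sorgTop_iff {U : Set ℝ} :
    IsOpen[sorgTop] U ↔ ∀ x ∈ U, ∃ ε > 0, Ico x (x + ε) ⊆ U := by
  constructor
  · intro hU
    induction hU with
    | basic s hs =>
      obtain ⟨a, b, rfl⟩ := hs
      exact fun x hx => ⟨b - x, sub_pos.2 hx.2, fun y hy => ⟨hx.1.trans hy.1, by linarith [hy.2]⟩⟩
    | univ => exact fun x _ => ⟨1, one_pos, subset_univ _⟩
    | inter s t _ _ hs ht =>
      rintro x ⟨hxs, hxt⟩
      obtain ⟨ε, hε, hs⟩ := hs x hxs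
      obtain ⟨δ, hδ, ht⟩ := ht x hxt
      refine ⟨min ε δ, lt_min hε hδ, fun y hy => ⟨hs ⟨hy.1, ?_⟩, ht ⟨hy.1, ?_⟩⟩⟩
      · linarith [hy.2, min_le_left ε δ]
      · linarith [hy.2, min_le_right ε δ]
    | sUnion S _ hS =>
      rintro x ⟨s, hs, hxs⟩
      obtain ⟨ε, hε, h⟩ := hS s hs x hxs
      exact ⟨ε, hε, h.trans (subset_sUnion_of_mem hs)⟩
  · intro h
    choose! ε hε h using h
    have hU : U = ⋃₀ ((fun x => Ico x (x + ε x)) '' U) := by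
      refine Subset.antisymm (fun x hx => ⟨_, mem_image_of_mem _ hx, le_rfl, ?_⟩) ?_
      · linarith [hε x hx]
      · rintro y ⟨_, ⟨x, hx, rfl⟩, hy⟩
        exact h x hx hy
    rw [hU]
    refine TopologicalSpace.GenerateOpen.sUnion _ ?_
    rintro _ ⟨x, -, rfl⟩
    exact .basic _ ⟨_, _, rfl⟩

theorem isOpen_sorgPlane_iff {U : Set (ℝ × ℝ)} :
    IsOpen[sorgPlane] U ↔
      ∀ p ∈ U, ∃ ε > 0, Ico p.1 (p.1 + ε) ×ˢ Ico p.2 (p.2 + ε) ⊆ U := by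
  refine (@isOpen_prod_iff ℝ ℝ sorgTop sorgTop U).trans ⟨fun h => ?_, fun h => ?_⟩
  · rintro ⟨a, b⟩ hab
    obtain ⟨u, v, hu, hv, ha, hb, huv⟩ := h a b hab
    obtain ⟨ε, hε, hu⟩ := isOpen_sorgTop_iff.1 hu a ha
    obtain ⟨δ, hδ, hv⟩ := isOpen_sorgTop_iff.1 hv b hb
    refine ⟨min ε δ, lt_min hε hδ, (prod_mono ?_ ?_).trans huv⟩
    · exact (Ico_subset_Ico_right (by simp)).trans hu
    · exact (Ico_subset_Ico_right (by simp)).trans hv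
  · intro a b hab
    obtain ⟨ε, hε, h⟩ := h _ hab
    exact ⟨Ico a (a + ε), Ico b (b + ε), .basic _ ⟨_, _, rfl⟩, .basic _ ⟨_, _, rfl⟩,
      ⟨le_rfl, by linarith⟩, ⟨le_rfl, by linarith⟩, h⟩

/-- The Sorgenfrey topology on the plane is finer than the Euclidean one. -/
theorem sorgPlane_le : sorgPlane ≤ instTopologicalSpaceProd := by
  intro U hU
  refine isOpen_sorgPlane_iff.2 fun p hp => ?_
  obtain ⟨ε, hε, h⟩ := Metric.isOpen_iff.1 hU p hp
  refine ⟨ε, hε, fun q hq => h ?_⟩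
  obtain ⟨⟨h1, h2⟩, h3, h4⟩ := hq
  rw [Metric.mem_ball, Prod.dist_eq, max_lt_iff, Real.dist_eq, Real.dist_eq, abs_lt, abs_lt]
  constructor <;> constructor <;> linarith

/-- Every subset of the antidiagonal is closed in the Sorgenfrey plane. -/
theorem isClosed_sorgPlane_of_subset_antidiagonal {A : Set (ℝ × ℝ)}
    (hA : ∀ p ∈ A, p.2 = -p.1) : IsClosed[sorgPlane] A := by
  refine (@isOpen_compl_iff _ _ sorgPlane).1 (isOpen_sorgPlane_iff.2 fun p hp => ?_)
  rcases lt_or_ge (p.1 + p.2) 0 with h | h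
  · refine ⟨-(p.1 + p.2) / 2, by linarith, ?_⟩
    rintro q ⟨⟨-, h1⟩, -, h2⟩ hq
    linarith [hA q hq]
  · refine ⟨1, one_pos, ?_⟩
    rintro q ⟨⟨h1, -⟩, h2, -⟩ hq
    have := hA q hq
    exact hp ((Prod.ext (by linarith) (by linarith) : q = p) ▸ hq)

theorem isClopen_sorgPlane_Ici (p : ℝ × ℝ) : @IsClopen _ sorgPlane (Ici p) := by
  refine ⟨isClosed_Ici.mono sorgPlane_le, isOpen_sorgPlane_iff.2 fun q hq => ⟨1, one_pos, ?_⟩⟩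
  rintro r ⟨⟨h1, -⟩, h2, -⟩
  exact ⟨hq.1.trans h1, hq.2.trans h2⟩

/-- Removing countably many clopen sets from a zero-set leaves a functionally closed set. -/
theorem functionallyClosedIn_diff_iUnion {X ι : Type*} [t : TopologicalSpace X] [Countable ι]
    {g : X → ℝ} (hg : Continuous g) {C : ι → Set X} (hC : ∀ i, IsClopen (C i)) :
    FunctionallyClosedIn t (g ⁻¹' {0} \ ⋃ i, C i) := by
  have := Encodable.ofCountable ι
  obtain ⟨w, hw, hc⟩ : ∃ w : ι → ℝ, (∀ i, 0 < w i) ∧ Summable w :=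
    let ⟨w, hw, hc⟩ := posSumOfEncodable one_pos ι
    ⟨w, hw, hc.imp fun _ h => h.1⟩
  have hnonneg (i : ι) (x : X) : 0 ≤ (C i).indicator (fun _ => w i) x :=
    indicator_nonneg (fun _ _ => (hw i).le) x
  have hle (i : ι) (x : X) : (C i).indicator (fun _ => w i) x ≤ w i :=
    indicator_le_self' (fun _ _ => (hw i).le) x
  have hsum (x : X) : Summable fun i => (C i).indicator (fun _ => w i) x :=
    hc.of_nonneg_of_le (hnonneg · x) (hle · x)
  have hcont : Continuous fun x => ∑' i, (C i).indicator (fun _ => w i) x := by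
    refine continuous_tsum (fun i => continuous_const.indicator ?_) hc fun i x => ?_
    · simp [(hC i).frontier_eq]
    · rw [Real.norm_of_nonneg (hnonneg i x)]
      exact hle i x
  refine ⟨fun x => min 1 (|g x| + ∑' i, (C i).indicator (fun _ => w i) x),
    continuous_const.min (hg.abs.add hcont), fun x => ⟨?_, min_le_left _ _⟩, ?_⟩
  · exact le_min zero_le_one (add_nonneg (abs_nonneg _) (tsum_nonneg (hnonneg · x)))
  · ext x
    have hmin (a : ℝ) : min 1 a = 0 ↔ a = 0 := by grind
    have hzero : ∑' i, (C i).indicator (fun _ => w i) x = 0 ↔ ∀ i, x ∉ C i := by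
      rw [← (hsum x).hasSum_iff, hasSum_zero_iff_of_nonneg (hnonneg · x)]
      simp [funext_iff, (hw _).ne']
    simp only [mem_sdiff, mem_preimage, mem_singleton_iff, mem_iUnion, not_exists, hmin,
      add_eq_zero_iff_of_nonneg (abs_nonneg _) (tsum_nonneg (hnonneg · x)), abs_eq_zero, hzero]

theorem not_completelySeparatedIn_antidiagonal :
    ¬ CompletelySeparatedIn sorgPlane
      {p : ℝ × ℝ | p.2 = -p.1 ∧ ∃ q : ℚ, p.1 = (q : ℝ)}
      {p : ℝ × ℝ | p.2 = -p.1 ∧ ¬ ∃ q : ℚ, p.1 = (q : ℝ)} := by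
  rintro ⟨f, hf, -, hE, hF⟩
  have hlt := isOpen_sorgPlane_iff.1
    (@IsOpen.preimage _ _ sorgPlane _ f hf _ (isOpen_Iio (a := (1 / 2 : ℝ))))
  have hgt := isOpen_sorgPlane_iff.1
    (@IsOpen.preimage _ _ sorgPlane _ f hf _ (isOpen_Ioi (a := (1 / 2 : ℝ))))
  let G (n : ℕ) : Set ℝ :=
    {x | Ico x (x + 1 / (n + 1)) ×ˢ Ico (-x) (-x + 1 / (n + 1)) ⊆ f ⁻¹' Ioi (1 / 2)}
  let K : ℕ ⊕ ℚ → Set ℝ := Sum.elim (fun n => closure (G n)) fun q => {(q : ℝ)}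
  have hK : ⋃ i, K i = univ := by
    refine eq_univ_of_forall fun x => mem_iUnion.2 ?_
    by_cases hx : ∃ q : ℚ, x = q
    · obtain ⟨q, hq⟩ := hx
      exact ⟨.inr q, hq⟩
    · obtain ⟨ε, hε, h⟩ := hgt (x, -x) (by
        rw [mem_preimage, hF (x, -x) ⟨rfl, hx⟩]
        norm_num)
      obtain ⟨n, hn⟩ := exists_nat_one_div_lt hε
      refine ⟨.inl n, subset_closure ((prod_mono ?_ ?_).trans h)⟩ <;>
        exact Ico_subset_Ico_right (by simpa using hn.le)
  obtain ⟨i | q, hi⟩ := nonempty_interior_of_iUnion_of_closed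
    (by rintro (n | q) <;> simp [K]) hK
  · obtain ⟨q, hq⟩ := Rat.denseRange_cast.exists_mem_open isOpen_interior hi
    obtain ⟨ε, hε, h⟩ := hlt ((q : ℝ), -(q : ℝ)) (by
      rw [mem_preimage, hE _ ⟨rfl, q, rfl⟩]
      norm_num)
    have hi0 : (0 : ℝ) < 1 / (i + 1) := by positivity
    obtain ⟨x, hx, hxq⟩ := Metric.mem_closure_iff.1 (interior_subset hq) _ (lt_min hε hi0)
    rw [Real.dist_eq, lt_min_iff, abs_lt, abs_lt] at hxq
    have h₁ : f _ < 1 / 2 := @h (max x q, max (-x) (-q)) ⟨by grind, by grind⟩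
    have h₂ : 1 / 2 < f _ := @hx (max x q, max (-x) (-q)) ⟨by grind, by grind⟩
    exact lt_asymm h₁ h₂
  · simp [K] at hi


/-- The Sorgenfrey plane is not δ-normally separated: the rational part `E` of the
anti-diagonal is closed, the irrational part `F` is functionally closed, they are
disjoint, yet not completely separated. -/
theorem sorgPlane_not_delta_normally_separated :
    IsClosed[sorgPlane] {p : ℝ × ℝ | p.2 = -p.1 ∧ ∃ q : ℚ, p.1 = (q : ℝ)} ∧
    FunctionallyClosedIn sorgPlane
      {p : ℝ × ℝ | p.2 = -p.1 ∧ ¬ ∃ q : ℚ, p.1 = (q : ℝ)} ∧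
    Disjoint {p : ℝ × ℝ | p.2 = -p.1 ∧ ∃ q : ℚ, p.1 = (q : ℝ)}
      {p : ℝ × ℝ | p.2 = -p.1 ∧ ¬ ∃ q : ℚ, p.1 = (q : ℝ)} ∧
    ¬ CompletelySeparatedIn sorgPlane
      {p : ℝ × ℝ | p.2 = -p.1 ∧ ∃ q : ℚ, p.1 = (q : ℝ)}
      {p : ℝ × ℝ | p.2 = -p.1 ∧ ¬ ∃ q : ℚ, p.1 = (q : ℝ)} := by
  refine ⟨isClosed_sorgPlane_of_subset_antidiagonal fun p hp => hp.1, ?_,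
    disjoint_left.2 fun p hE hF => hF.2 hE.2, not_completelySeparatedIn_antidiagonal⟩
  have hsum : Continuous[sorgPlane, inferInstance] fun p : ℝ × ℝ => p.1 + p.2 :=
    continuous_le_dom sorgPlane_le (continuous_fst.add continuous_snd)
  convert @functionallyClosedIn_diff_iUnion _ ℚ sorgPlane _ _ hsum _
    fun q => isClopen_sorgPlane_Ici ((q : ℝ), -(q : ℝ)) using 1
  ext ⟨a, b⟩
  simp only [mem_ofPred_eq, mem_sdiff, mem_preimage, mem_singleton_iff, mem_iUnion, mem_Ici,
    Prod.mk_le_mk]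
  grind
end
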